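/- Let M be a finitely generated conical refinement monoid in which every element is regular (i.e. 2x ≤ x for all x ∈ M). Then there exists a countable row-finite directed graph E such that M ≅ M(E). -/

import Mathlib

namespace ArPardo

/-- A countable row-finite directed graph `E = (E⁰, E¹, s, r)`. -/
structure RowFiniteGraph : Type 1 where
  V : Type
  E : Type
  countableV : Countable V
  countableE : Countable E
  s : E → V
  r : E → V
  rowFinite : ∀ v : V, {e : E | s e = v}.Finite

/-- The defining relations of the graph monoid, as a relation on the free
commutative monoid `V →₀ ℕ` on the vertices: for every vertex `v` emitting
at least one edge, `a_v = Σ_{e ∈ s⁻¹(v)} a_{r(e)}`. -/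
def graphRel (G : RowFiniteGraph) (x y : G.V →₀ ℕ) : Prop :=
  ∃ v : G.V, (∃ e : G.E, G.s e = v) ∧ x = Finsupp.single v 1 ∧
    y = ∑ e ∈ (G.rowFinite v).toFinset, Finsupp.single (G.r e) 1

/-- The graph monoid `M(E)`: the quotient of the free commutative monoid on the
vertices by the congruence generated by the graph relations. -/
def graphMonoid (G : RowFiniteGraph) : Type :=
  (addConGen (graphRel G)).Quotient

noncomputable instance (G : RowFiniteGraph) : AddCommMonoid (graphMonoid G) :=
  inferInstanceAs (AddCommMonoid (addConGen (graphRel G)).Quotient)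

/-- The canonical generator `a_v` of the graph monoid. -/
noncomputable def vertexElem (G : RowFiniteGraph) (v : G.V) : graphMonoid G :=
  (addConGen (graphRel G)).mk' (Finsupp.single v 1)

/-- A commutative monoid is a graph monoid if it is isomorphic to `M(E)` for some
(countable) row-finite directed graph `E`. -/
def IsGraphMonoid (M : Type) [AddCommMonoid M] : Prop :=
  ∃ G : RowFiniteGraph, Nonempty (M ≃+ graphMonoid G)

/-- The algebraic preorder on a commutative monoid: `x ≤ y` iff `y = x + z`. -/
def algLE {M : Type} [AddCommMonoid M] (x y : M) : Prop :=
  ∃ z : M, y = x + z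

/-- A commutative monoid is conical if `x + y = 0` implies `x = y = 0`. -/
def IsConical (M : Type) [AddCommMonoid M] : Prop :=
  ∀ x y : M, x + y = 0 → x = 0 ∧ y = 0

/-- The Riesz refinement property. -/
def IsRefinement (M : Type) [AddCommMonoid M] : Prop :=
  ∀ a b c d : M, a + b = c + d →
    ∃ w x y z : M, a = w + x ∧ b = y + z ∧ c = w + y ∧ d = x + z

/-- A prime element: not invertible, and `p ≤ a + b` implies `p ≤ a` or `p ≤ b`. -/
def IsPrimeElem {M : Type} [AddCommMonoid M] (p : M) : Prop :=
  (∀ q : M, p + q ≠ 0) ∧ ∀ a b : M, algLE p (a + b) → algLE p a ∨ algLE p b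

/-- A free element: `n • p ≤ m • p` implies `n ≤ m`. -/
def IsFreeElem {M : Type} [AddCommMonoid M] (p : M) : Prop :=
  ∀ n m : ℕ, algLE (n • p) (m • p) → n ≤ m

/-- A regular element: `2x ≤ x`. -/
def IsRegularElem {M : Type} [AddCommMonoid M] (x : M) : Prop :=
  algLE (x + x) x

/-- `q̄ < p̄` in the poset of (classes of) elements: `q ≤ p` and `p ≰ q`. -/
def classLT {M : Type} [AddCommMonoid M] (q p : M) : Prop :=
  algLE q p ∧ ¬ algLE p q

/-- `q` is a prime whose class lies in the lower cover of the class of the prime `p`: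
`q̄ < p̄` and no prime class lies strictly between. -/
def InLowerCover {M : Type} [AddCommMonoid M] (p q : M) : Prop :=
  IsPrimeElem q ∧ classLT q p ∧
    ¬ ∃ t : M, IsPrimeElem t ∧ classLT q t ∧ classLT t p

/-- `Q` is a (finite) set of representatives of the classes in the lower cover of `p̄`:
its elements are in the lower cover, pairwise inequivalent, and every prime in the
lower cover is equivalent to one of them. -/
def IsLowerCoverReps {M : Type} [AddCommMonoid M] (p : M) (Q : Finset M) : Prop :=
  (∀ q ∈ Q, InLowerCover p q) ∧
  (∀ q ∈ Q, ∀ q' ∈ Q, algLE q q' → algLE q' q → q = q') ∧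
  (∀ t : M, InLowerCover p t → ∃ q ∈ Q, algLE q t ∧ algLE t q)

/-- The underlying set of the group `G'_p = {p + α : α ∈ M, p + α ≤ p}`. -/
def GpSet {M : Type} [AddCommMonoid M] (p : M) : Set M :=
  {y | ∃ α : M, y = p + α ∧ algLE y p}

/-- `j : G' → M` realizes the abelian group `G'` as the group
`G'_p = {p + α : p + α ≤ p}` with identity `p` and operation
`(p + α) ∘ (p + β) = p + (α + β)`. -/
structure GpStructure (M : Type) [AddCommMonoid M] (p : M)
    (G' : Type) [AddCommGroup G'] (j : G' → M) : Prop where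
  inj : Function.Injective j
  range_eq : Set.range j = GpSet p
  map_zero : j 0 = p
  map_add : ∀ (u v : G') (α β : M), j u = p + α → j v = p + β → j (u + v) = p + (α + β)

/-- The archimedean component of `s`: all `a` with `a ≤ n • s` and `s ≤ m • a` for
some positive integers `n, m`; it is a subsemigroup. -/
def archComp {M : Type} [AddCommMonoid M] (s : M) : AddSubsemigroup M where
  carrier := {a : M | ∃ n m : ℕ, 0 < n ∧ 0 < m ∧ algLE a (n • s) ∧ algLE s (m • a)}
  add_mem' := by
    rintro a b ⟨n, m, hn, hm, ⟨z, hz⟩, ⟨w, hw⟩⟩ ⟨n', m', hn', hm', ⟨z', hz'⟩, ⟨w', hw'⟩⟩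
    refine ⟨n + n', m, Nat.add_pos_left hn _, hm, ⟨z + z', ?_⟩, ⟨w + m • b, ?_⟩⟩
    · rw [add_nsmul, hz, hz']; abel
    · rw [nsmul_add, hw]; abel

/-- `(Γ, ι)` is a Grothendieck group of the commutative semigroup `S`: every
semigroup homomorphism from `S` to an abelian group factors uniquely through `ι`. -/
def IsGrothendieck (S : Type) [Add S] (Γ : Type) [AddCommGroup Γ] (ι : AddHom S Γ) : Prop :=
  ∀ (A : Type) [AddCommGroup A], ∀ f : AddHom S A, ∃! g : Γ →+ A, ∀ x : S, g (ι x) = f x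

/-- The almost-isomorphism condition at a free prime `p`, with `Q` a set of
representatives of the lower cover of `p̄`, and `s_p = Σ_{q ∈ Q} q`: for every
Grothendieck group `ι : M_{J_p} → Γ` of the archimedean component `M_{J_p}` of `s_p`,
every realization `(G', j)` of the group `G'_p`, every incarnation
`φp : M_{J_p} → G'` of the map `x ↦ p + x`, the unique group homomorphism
`ψ = G(φ_p) : Γ → G'` with `ψ ∘ ι = φp` is surjective and its kernel is the cyclic
subgroup generated by `ι x` for some `x ∈ M_{J_p}`. -/
def AlmostIsoCondition (M : Type) [AddCommMonoid M] (p : M) (Q : Finset M) : Prop :=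
  ∀ (Γ : Type) [AddCommGroup Γ],
    ∀ ι : AddHom (archComp (∑ q ∈ Q, (q : M))) Γ,
    IsGrothendieck (archComp (∑ q ∈ Q, (q : M))) Γ ι →
    ∀ (G' : Type) [AddCommGroup G'], ∀ j : G' → M, GpStructure M p G' j →
    ∀ φp : AddHom (archComp (∑ q ∈ Q, (q : M))) G',
      (∀ a : archComp (∑ q ∈ Q, (q : M)), j (φp a) = p + (a : M)) →
    ∀ ψ : Γ →+ G', (∀ a, ψ (ι a) = φp a) →
      Function.Surjective ψ ∧
        ∃ x : archComp (∑ q ∈ Q, (q : M)), ψ.ker = AddSubgroup.zmultiples (ι x)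

/-- An order-ideal of a commutative monoid. -/
def IsOrderIdeal {M : Type} [AddCommMonoid M] (S : Set M) : Prop :=
  (0 : M) ∈ S ∧ (∀ x y : M, x ∈ S → y ∈ S → x + y ∈ S) ∧
    ∀ x y : M, algLE x y → y ∈ S → x ∈ S

/-- The order-ideal generated by a subset: the smallest order-ideal containing it. -/
def orderIdealGen {M : Type} [AddCommMonoid M] (X : Set M) : Set M :=
  ⋂₀ {S : Set M | IsOrderIdeal S ∧ X ⊆ S}

/-- The restriction graph `E_H` of a hereditary subset `H` of the vertices. -/
def restrictGraph (G : RowFiniteGraph) (H : Set G.V)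
    (hher : ∀ e : G.E, G.s e ∈ H → G.r e ∈ H) : RowFiniteGraph where
  V := ↥H
  E := {e : G.E // G.s e ∈ H}
  countableV := by have := G.countableV; exact inferInstance
  countableE := by have := G.countableE; exact inferInstance
  s := fun e => ⟨G.s e.1, e.2⟩
  r := fun e => ⟨G.r e.1, hher e.1 e.2⟩
  rowFinite := fun v => by
    have hsub : {e : {e : G.E // G.s e ∈ H} | (⟨G.s e.1, e.2⟩ : ↥H) = v}
        ⊆ Subtype.val ⁻¹' {e : G.E | G.s e = (v : G.V)} := by
      intro e he
      simpa [Subtype.ext_iff] using he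
    exact Set.Finite.subset
      (Set.Finite.preimage (Subtype.val_injective.injOn) (G.rowFinite (v : G.V))) hsub

section AlgebraicPreorder

variable {M : Type} [AddCommMonoid M]

lemma algLE.refl (x : M) : algLE x x := ⟨0, (add_zero x).symm⟩

lemma algLE.trans {x y z : M} (hxy : algLE x y) (hyz : algLE y z) : algLE x z := by
  obtain ⟨a, rfl⟩ := hxy
  obtain ⟨b, rfl⟩ := hyz
  exact ⟨a + b, add_assoc _ _ _⟩

lemma algLE_add_right (x y : M) : algLE x (x + y) := ⟨y, rfl⟩

lemma algLE_add_left (x y : M) : algLE x (y + x) := ⟨y, add_comm _ _⟩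

lemma zero_algLE (x : M) : algLE 0 x := ⟨x, (zero_add x).symm⟩

/-- Below a regular element, the algebraic preorder is closed under sums. -/
lemma algLE.add_le_of_isRegularElem {a b y : M} (hy : IsRegularElem y)
    (ha : algLE a y) (hb : algLE b y) : algLE (a + b) y := by
  refine algLE.trans ?_ hy
  obtain ⟨c, hc⟩ := ha
  obtain ⟨d, hd⟩ := hb
  exact ⟨c + d, by rw [add_add_add_comm, ← hc, ← hd]⟩

/-- An element absorbed by `x` is absorbed by everything above `x`. -/
lemma algLE.absorb {x y z : M} (hxy : algLE x y) (hx : x + z = x) : y + z = y := by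
  obtain ⟨c, rfl⟩ := hxy
  rw [add_right_comm, hx]

/-- In a regular monoid, `x ≤ y` as soon as every generator below `x` is below `y`. -/
lemma algLE_of_forall_generator {S : Set M} (hS : AddSubmonoid.closure S = ⊤)
    (hreg : ∀ x : M, IsRegularElem x) {x y : M}
    (h : ∀ s ∈ S, algLE s x → algLE s y) : algLE x y := by
  have hx : x ∈ AddSubmonoid.closure S := hS ▸ AddSubmonoid.mem_top x
  induction hx using AddSubmonoid.closure_induction with
  | mem s hs => exact h s hs (algLE.refl s)
  | zero => exact zero_algLE y
  | add a b _ _ iha ihb =>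
    exact algLE.add_le_of_isRegularElem (hreg y)
      (iha fun s hs hsa => h s hs (hsa.trans (algLE_add_right a b)))
      (ihb fun s hs hsb => h s hs (hsb.trans (algLE_add_left b a)))

/-- A nonzero element that is not prime splits into two strictly smaller summands. -/
lemma exists_add_of_not_isPrimeElem (hcon : IsConical M) (href : IsRefinement M) {x : M}
    (hx : x ≠ 0) (hp : ¬ IsPrimeElem x) :
    ∃ y z : M, x = y + z ∧ ¬ algLE x y ∧ ¬ algLE x z := by
  have hx' : ∀ q : M, x + q ≠ 0 := fun q hq => hx (hcon x q hq).1
  simp only [IsPrimeElem, hx', not_forall, not_or, ne_eq, not_false_eq_true,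
    implies_true, true_and] at hp
  obtain ⟨a, b, ⟨c, hc⟩, ha, hb⟩ := hp
  obtain ⟨w, u, y, z, hxw, -, haw, hbu⟩ := href x c a b hc.symm
  exact ⟨w, u, hxw, fun h => ha (h.trans ⟨y, haw⟩), fun h => hb (h.trans ⟨z, hbu⟩)⟩

/-- A finitely generated regular conical refinement monoid is generated by its primes. -/
lemma closure_isPrimeElem_eq_top [AddMonoid.FG M] (hcon : IsConical M) (href : IsRefinement M)
    (hreg : ∀ x : M, IsRegularElem x) :
    AddSubmonoid.closure {p : M | IsPrimeElem p} = ⊤ := by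
  classical
  obtain ⟨S, hS⟩ := (AddMonoid.FG.fg_top : (⊤ : AddSubmonoid M).FG)
  let below : M → Finset M := fun x => S.filter fun s => algLE s x
  have below_ssubset {x y : M} (hyx : algLE y x) (hxy : ¬ algLE x y) : below y ⊂ below x := by
    refine Finset.ssubset_iff_subset_ne.2 ⟨fun s hs => ?_, fun h => hxy ?_⟩
    · simp only [below, Finset.mem_filter] at hs ⊢
      exact ⟨hs.1, hs.2.trans hyx⟩
    · refine algLE_of_forall_generator hS hreg fun s hs hsx => ?_
      have : s ∈ below y := h ▸ Finset.mem_filter.2 ⟨hs, hsx⟩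
      exact (Finset.mem_filter.1 this).2
  refine (AddSubmonoid.eq_top_iff' _).2 fun x => ?_
  induction hn : (below x).card using Nat.strong_induction_on generalizing x with
  | _ n ih =>
    subst hn
    by_cases hx : x = 0
    · exact hx ▸ zero_mem _
    by_cases hp : IsPrimeElem x
    · exact AddSubmonoid.subset_closure hp
    obtain ⟨y, z, rfl, hy, hz⟩ := exists_add_of_not_isPrimeElem hcon href hx hp
    exact add_mem
      (ih _ (Finset.card_lt_card (below_ssubset (algLE_add_right y z) hy)) y rfl)
      (ih _ (Finset.card_lt_card (below_ssubset (algLE_add_left z y) hz)) z rfl)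

/-- A finitely generated commutative monoid is countable. -/
lemma countable_of_addMonoid_fg [AddMonoid.FG M] : Countable M := by
  obtain ⟨S, hS⟩ := (AddMonoid.FG.fg_top : (⊤ : AddSubmonoid M).FG)
  have hsurj : Function.Surjective (Finsupp.liftAddHom fun s : S => multiplesHom M (s : M)) := by
    rw [← AddMonoidHom.mrange_eq_top, eq_top_iff, ← hS, AddSubmonoid.closure_le]
    exact fun s hs => ⟨Finsupp.single ⟨s, hs⟩ 1, by simp⟩
  exact hsurj.countable

end AlgebraicPreorder

section GraphOfRelations

variable {V : Type}

/-- Induction on finitely supported functions to `ℕ` as sums of single vertices. -/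
lemma _root_.Finsupp.induction_single_one {motive : (V →₀ ℕ) → Prop} (f : V →₀ ℕ)
    (zero : motive 0) (single : ∀ v, motive (Finsupp.single v 1))
    (add : ∀ f g, motive f → motive g → motive (f + g)) : motive f := by
  induction f using Finsupp.induction_linear with
  | zero => exact zero
  | add f g hf hg => exact add f g hf hg
  | single v n =>
    induction n with
    | zero => rwa [Finsupp.single_zero]
    | succ n ih =>
      rw [Finsupp.single_add]
      exact add _ _ ih (single v)

lemma sum_toFinset_sigma_get {N : Type} [AddCommMonoid N] (l : V → List V) (v : V)
    (h : {e : Σ v : V, Fin (l v).length | e.1 = v}.Finite) (f : V → N) :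
    ∑ e ∈ h.toFinset, f ((l e.1).get e.2) = ((l v).map f).sum := by
  have himage : h.toFinset = Finset.univ.map (Function.Embedding.sigmaMk v) := by
    ext ⟨u, i⟩
    rw [Set.Finite.mem_toFinset, Finset.mem_map]
    constructor
    · rintro rfl
      exact ⟨i, Finset.mem_univ i, rfl⟩
    · rintro ⟨j, -, hj⟩
      exact (congrArg Sigma.fst hj).symm
  rw [himage, Finset.sum_map, ← List.sum_ofFn]
  congr 1
  exact List.ext_get (by simp) fun n _ _ => by simp [Function.Embedding.sigmaMk]

variable [Countable V]

/-- The row-finite graph whose vertex `v` emits `ρ v w` edges to `w`. -/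
noncomputable def graphOfRelations (ρ : V → V →₀ ℕ) : RowFiniteGraph where
  V := V
  E := Σ v : V, Fin (Finsupp.toMultiset (ρ v)).toList.length
  countableV := inferInstance
  countableE := inferInstance
  s := Sigma.fst
  r := fun e => (Finsupp.toMultiset (ρ e.1)).toList.get e.2
  rowFinite := fun v => (Set.finite_range (Sigma.mk v)).subset <| by
    rintro ⟨_, i⟩ rfl
    exact ⟨i, rfl⟩

lemma sum_graphOfRelations (ρ : V → V →₀ ℕ) (v : V) :
    ∑ e ∈ ((graphOfRelations ρ).rowFinite v).toFinset,
      Finsupp.single ((graphOfRelations ρ).r e) 1 = ρ v := by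
  refine (sum_toFinset_sigma_get (fun v => (Finsupp.toMultiset (ρ v)).toList) v
    ((graphOfRelations ρ).rowFinite v) fun w => Finsupp.single w 1).trans ?_
  change (List.map (fun w => (Finsupp.single w 1 : V →₀ ℕ)) _).sum = ρ v
  rw [← Multiset.sum_coe, ← Multiset.map_coe, Multiset.coe_toList]
  induction ρ v using Finsupp.induction_single_one with
  | zero => simp
  | add f g hf hg => rw [map_add, Multiset.map_add, Multiset.sum_add, hf, hg]
  | single w => simp [Finsupp.toMultiset_single]

lemma graphRel_graphOfRelations {ρ : V → V →₀ ℕ} (hρ : ∀ v, ρ v ≠ 0) {x y : V →₀ ℕ} :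
    graphRel (graphOfRelations ρ) x y ↔ ∃ v, x = Finsupp.single v 1 ∧ y = ρ v := by
  have hemit (v : V) : ∃ e : (graphOfRelations ρ).E, (graphOfRelations ρ).s e = v := by
    by_contra h
    refine hρ v ?_
    rw [← sum_graphOfRelations ρ v]
    exact Finset.sum_eq_zero fun e he =>
      (h ⟨e, ((graphOfRelations ρ).rowFinite v).mem_toFinset.1 he⟩).elim
  constructor
  · rintro ⟨v, -, hx, hy⟩
    exact ⟨v, hx, hy.trans (sum_graphOfRelations ρ v)⟩
  · rintro ⟨v, hx, hy⟩
    exact ⟨v, hemit v, hx, hy.trans (sum_graphOfRelations ρ v).symm⟩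

/-- If the kernel congruence of a surjection `π` is generated by the relations
`single v 1 ~ ρ v`, then the codomain of `π` is a graph monoid. -/
lemma isGraphMonoid_of_relations {M : Type} [AddCommMonoid M] {ρ : V → V →₀ ℕ}
    (hρ : ∀ v, ρ v ≠ 0) (π : (V →₀ ℕ) →+ M) (hπ : Function.Surjective π)
    (hsound : ∀ v, π (ρ v) = π (Finsupp.single v 1))
    (hcomplete : ∀ c : AddCon (V →₀ ℕ), (∀ v, c (Finsupp.single v 1) (ρ v)) →
      ∀ x y, π x = π y → c x y) : IsGraphMonoid M := by
  refine ⟨graphOfRelations ρ, ⟨AddEquiv.symm ?_⟩⟩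
  have hle : addConGen (graphRel (graphOfRelations ρ)) ≤ AddCon.ker π := by
    refine AddCon.addConGen_le.2 fun x y hxy => ?_
    obtain ⟨v, rfl, rfl⟩ := (graphRel_graphOfRelations hρ).1 hxy
    exact (hsound v).symm
  refine AddEquiv.ofBijective (AddCon.lift (addConGen (graphRel (graphOfRelations ρ))) π hle)
    ⟨?_, AddCon.lift_surjective_of_surjective hle hπ⟩
  intro x y
  induction x, y using AddCon.induction_on₂ with
  | _ x y =>
    intro hxy
    exact (AddCon.eq _).2 (hcomplete _
      (fun v => AddConGen.Rel.of _ _ ((graphRel_graphOfRelations hρ).2 ⟨v, rfl, rfl⟩)) x y hxy)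

end GraphOfRelations

section PrimeVertices

variable {V M : Type} [AddCommMonoid M] {π : (V →₀ ℕ) →+ M}

/-- A prime element below the image of a sum of vertices is below the image of one of them. -/
lemma exists_vertex_of_isPrimeElem {p : M} (hp : IsPrimeElem p) {w : V →₀ ℕ}
    (h : algLE p (π w)) :
    ∃ (v : V) (w' : V →₀ ℕ), w = Finsupp.single v 1 + w' ∧ algLE p (π (Finsupp.single v 1)) := by
  induction w using Finsupp.induction_single_one with
  | zero =>
    obtain ⟨q, hq⟩ := h
    exact (hp.1 q (by rw [← hq, map_zero])).elim
  | single v => exact ⟨v, 0, (add_zero _).symm, h⟩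
  | add f g hf hg =>
    rw [map_add] at h
    rcases hp.2 _ _ h with h | h
    · obtain ⟨v, w', rfl, hv⟩ := hf h
      exact ⟨v, w' + g, add_assoc _ _ _, hv⟩
    · obtain ⟨v, w', rfl, hv⟩ := hg h
      exact ⟨v, f + w', add_left_comm _ _ _, hv⟩

/-- Let `π` be a surjection onto a regular conical refinement monoid sending every vertex to a
prime. A congruence for which every vertex absorbs whatever its image absorbs contains the kernel
congruence of `π`. -/
lemma rel_of_absorb (hcon : IsConical M) (href : IsRefinement M)
    (hreg : ∀ x : M, IsRegularElem x) (hπ : Function.Surjective π)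
    (hprime : ∀ v, IsPrimeElem (π (Finsupp.single v 1))) (c : AddCon (V →₀ ℕ))
    (habsorb : ∀ v y, π (Finsupp.single v 1) + π y = π (Finsupp.single v 1) →
      c (Finsupp.single v 1 + y) (Finsupp.single v 1))
    (x y : V →₀ ℕ) (hxy : π x = π y) : c x y := by
  have vertex_rel (v : V) (w : V →₀ ℕ) (hw : π w = π (Finsupp.single v 1)) :
      c (Finsupp.single v 1) w := by
    obtain ⟨u, w', rfl, hu⟩ := exists_vertex_of_isPrimeElem (π := π) (w := w) (hprime v)
      (by rw [hw]; exact algLE.refl _)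
    obtain ⟨t, ht⟩ := hreg (π (Finsupp.single v 1))
    obtain ⟨t, rfl⟩ := hπ t
    have h1 := habsorb v (t + (Finsupp.single u 1 + w')) (by
      rw [map_add, hw, add_comm (π t), ← add_assoc]; exact ht.symm)
    have h2 := habsorb u (Finsupp.single v 1 + t) (hu.absorb (by
      rw [map_add, ← add_assoc]; exact ht.symm))
    have h3 := c.add h2 (c.refl w')
    refine c.trans (c.symm h1) ?_
    convert h3 using 1
    abel
  have split (x : V →₀ ℕ) : ∀ a b : M, π x = a + b →
      ∃ y z : V →₀ ℕ, c x (y + z) ∧ π y = a ∧ π z = b := by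
    induction x using Finsupp.induction_single_one with
    | zero =>
      intro a b h
      obtain ⟨rfl, rfl⟩ := hcon a b (by rw [← h, map_zero])
      exact ⟨0, 0, by simpa using c.refl 0, map_zero π, map_zero π⟩
    | single v =>
      intro a b h
      obtain ⟨y, rfl⟩ := hπ a
      obtain ⟨z, rfl⟩ := hπ b
      exact ⟨y, z, vertex_rel v _ (by rw [map_add, h]), rfl, rfl⟩
    | add f g hf hg =>
      intro a b h
      rw [map_add] at h
      obtain ⟨a₁, b₁, a₂, b₂, h₁, h₂, rfl, rfl⟩ := href _ _ _ _ h
      obtain ⟨y₁, z₁, hc₁, rfl, rfl⟩ := hf _ _ h₁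
      obtain ⟨y₂, z₂, hc₂, rfl, rfl⟩ := hg _ _ h₂
      refine ⟨y₁ + y₂, z₁ + z₂, ?_, map_add _ _ _, map_add _ _ _⟩
      rw [add_add_add_comm]
      exact c.add hc₁ hc₂
  induction y using Finsupp.induction_single_one generalizing x with
  | zero =>
    rw [map_zero] at hxy
    induction x using Finsupp.induction_single_one with
    | zero => exact c.refl 0
    | single v => exact ((hprime v).1 0 (by rw [hxy, add_zero])).elim
    | add f g hf hg =>
      rw [map_add] at hxy
      obtain ⟨hf0, hg0⟩ := hcon _ _ hxy
      simpa using c.add (hf hf0) (hg hg0)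
  | single v => exact c.symm (vertex_rel v x hxy)
  | add f g hf hg =>
    obtain ⟨y, z, hc, hy, hz⟩ := split x _ _ (hxy.trans (map_add π f g))
    exact c.trans hc (c.add (hf y hy) (hg z hz))

end PrimeVertices

section AbsorptionGraph

variable {P : Type}

/-- The element of the free monoid on `P × ℕ × Bool` that the vertex `v` is made to absorb.
The vertices `(p, k, false)` form an infinite path passing to every `(p, k, true)`, and
`(p, k, true)` absorbs the `k`-th term of the sequence `y p` together with the root
`(p, 0, false)` of the path. -/
noncomputable def absorbed (t : P → (P × ℕ × Bool →₀ ℕ)) (y : P → ℕ → (P × ℕ × Bool →₀ ℕ)) :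
    P × ℕ × Bool → (P × ℕ × Bool →₀ ℕ)
  | (p, k, false) => Finsupp.single (p, k + 1, false) 1 + Finsupp.single (p, k, true) 1 + t p
  | (p, k, true) => y p k + Finsupp.single (p, 0, false) 1

/-- In a congruence imposing the relations of `absorbed`, every vertex over `p` absorbs every term
of `y p` together with the root of the path over `p`. -/
lemma rel_of_absorbed {t : P → (P × ℕ × Bool →₀ ℕ)} {y : P → ℕ → (P × ℕ × Bool →₀ ℕ)}
    (c : AddCon (P × ℕ × Bool →₀ ℕ))
    (hc : ∀ v, c (Finsupp.single v 1) (Finsupp.single v 1 + absorbed t y v))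
    (p : P) (j k : ℕ) (b : Bool) :
    c (Finsupp.single (p, j, b) 1 + (y p k + Finsupp.single (p, 0, false) 1))
      (Finsupp.single (p, j, b) 1) := by
  let q (v : P × ℕ × Bool) : c.Quotient := ((Finsupp.single v 1 : P × ℕ × Bool →₀ ℕ) : c.Quotient)
  have hq (v : P × ℕ × Bool) : q v = q v + (absorbed t y v : c.Quotient) := (AddCon.eq c).2 (hc v)
  have hpath (k : ℕ) : q (p, k, false)
      = q (p, k, false) + (q (p, k + 1, false) + q (p, k, true) + (t p : c.Quotient)) :=
    hq (p, k, false)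
  have hloop (k : ℕ) : q (p, k, true)
      = q (p, k, true) + ((y p k : c.Quotient) + q (p, 0, false)) := hq (p, k, true)
  have hroot (k : ℕ) : algLE (q (p, k, false)) (q (p, 0, false)) := by
    induction k with
    | zero => exact algLE.refl _
    | succ k ih =>
      refine algLE.trans ⟨q (p, k, false) + (q (p, k, true) + (t p : c.Quotient)), ?_⟩ ih
      conv_lhs => rw [hpath k]
      abel
  have htrue (k : ℕ) : algLE (q (p, k, true)) (q (p, k, false)) := by
    refine ⟨q (p, k, false) + (q (p, k + 1, false) + (t p : c.Quotient)), ?_⟩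
    conv_lhs => rw [hpath k]
    abel
  have hback (j : ℕ) : algLE (q (p, 0, false)) (q (p, j, true)) := by
    refine ⟨q (p, j, true) + (y p j : c.Quotient), ?_⟩
    conv_lhs => rw [hloop j]
    abel
  have hle : algLE (q (p, k, true)) (q (p, j, b)) := by
    have h : algLE (q (p, k, true)) (q (p, j, true)) :=
      ((htrue k).trans (hroot k)).trans (hback j)
    cases b
    · exact h.trans (htrue j)
    · exact h
  exact (AddCon.eq c).1 (hle.absorb (hloop k).symm)

end AbsorptionGraph

/-- Every finitely generated conical refinement monoid in which
every element is regular (`2x ≤ x` for all `x`) is a graph monoid. -/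
theorem fg_regular_conical_refinement_isGraphMonoid (M : Type) [AddCommMonoid M]
    [AddMonoid.FG M] (hcon : IsConical M) (href : IsRefinement M)
    (hreg : ∀ x : M, IsRegularElem x) :
    ∃ G : RowFiniteGraph, Nonempty (M ≃+ graphMonoid G) := by
  have : Countable M := countable_of_addMonoid_fg
  let P : Type := {p : M // IsPrimeElem p}
  let V : Type := P × ℕ × Bool
  let π : (V →₀ ℕ) →+ M := Finsupp.liftAddHom fun v : V => multiplesHom M (v.1 : M)
  have hπv (v : V) : π (Finsupp.single v 1) = v.1 := by simp [π]
  have hπ : Function.Surjective π := by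
    rw [← AddMonoidHom.mrange_eq_top, eq_top_iff, ← closure_isPrimeElem_eq_top hcon href hreg,
      AddSubmonoid.closure_le]
    exact fun p hp => ⟨Finsupp.single (⟨p, hp⟩, 0, false) 1, hπv _⟩
  have htwo (p : M) : ∃ z, p + p + π z = p := by
    obtain ⟨x, hx⟩ := hreg p
    obtain ⟨z, rfl⟩ := hπ x
    exact ⟨z, hx.symm⟩
  have hthree (p : M) : ∃ z, p + p + p + π z = p := by
    obtain ⟨z, hz⟩ := htwo p
    refine ⟨z + z, ?_⟩
    calc p + p + p + π (z + z) = p + p + π z + p + π z := by rw [map_add]; abel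
      _ = p := by rw [hz, hz]
  have henum (p : M) : ∃ y : ℕ → (V →₀ ℕ), ∀ z, (∃ k, y k = z) ↔ p + p + π z = p := by
    have : Nonempty {z : V →₀ ℕ // p + p + π z = p} := let ⟨z, hz⟩ := htwo p; ⟨⟨z, hz⟩⟩
    obtain ⟨y, hy⟩ := exists_surjective_nat {z : V →₀ ℕ // p + p + π z = p}
    refine ⟨fun k => y k, fun z => ⟨?_, fun hz => ?_⟩⟩
    · rintro ⟨k, rfl⟩
      exact (y k).2
    · obtain ⟨k, hk⟩ := hy ⟨z, hz⟩
      exact ⟨k, congrArg Subtype.val hk⟩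
  choose t ht using hthree
  choose y hy using henum
  refine isGraphMonoid_of_relations
    (ρ := fun v : V => Finsupp.single v 1
      + absorbed (fun p : P => t (p : M)) (fun p : P => y (p : M)) v)
    (fun v h => ?_) π hπ ?_ ?_
  · exact one_ne_zero (Finsupp.single_eq_zero.1 (add_eq_zero.1 h).1)
  · rintro ⟨p, k, b⟩
    cases b
    · simp only [absorbed, map_add, hπv]
      rw [← add_assoc, ← add_assoc]
      exact ht p
    · simp only [absorbed, map_add, hπv]
      rw [add_comm (π _), ← add_assoc]
      exact (hy p _).1 ⟨k, rfl⟩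
  · intro c hc
    refine rel_of_absorb hcon href hreg hπ (fun v => (hπv v).symm ▸ v.1.2) c ?_
    rintro ⟨p, j, b⟩ z hz
    rw [hπv] at hz
    obtain ⟨u, hu⟩ := htwo (p : M)
    obtain ⟨k₀, hk₀⟩ := (hy p u).2 hu
    obtain ⟨k, hk⟩ := (hy p (u + z)).2 (by
      rw [map_add, ← add_assoc, hu, hz])
    have h₀ := rel_of_absorbed c hc p j k₀ b
    have h₁ := rel_of_absorbed c hc p j k b
    rw [hk₀] at h₀
    rw [hk] at h₁
    refine c.trans (c.symm (c.add h₀ (c.refl z))) ?_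
    convert h₁ using 1
    abel

end ArPardo
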